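/- Let d ≥ 1, m > 0 and γ ∈ [0,(d+1)/2). There exists a constant c ∈ (0,1], depending only on d, γ and m, such that for every r ≥ 1 and every n ∈ ℕ: (i) if g(r) = r^{−γ}, then G_n(r) ≥ c^{n−1} ( Γ(d−γ)ⁿ / Γ((d−γ)n) ) r^{((d+1)/2 − γ)(n−1)}; and (ii) if g(r) = (max(1,r))^{−γ}, then G_n(r) ≥ c^{n−1} ( Γ(d)ⁿ / Γ(dn) ) r^{((d+1)/2 − γ)(n−1)}. -/

import Mathlib

open MeasureTheory Filter Topology ENNReal Set

noncomputable section

/-- `GfunA d m g n` is the function `G_{n+1}`: `G₁ ≡ 1`, `G_{n+1}(0) = 0`, and for `r > 0`: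
for `d = 1`, `G_{n+1}(r) = (1/g(r)) ∫₀^r g(r−ρ) g(ρ) G_n(ρ) dρ`; for `d ≥ 2`,
`G_{n+1}(r) = (1/(g(r) r^{(d−1)/2})) ∫₀^r (∫₀^{√(min(ρ,r−ρ))} e^{−ms²} s^{d−2} ds)
  g(r−ρ)(r−ρ)^{(d−1)/2} g(ρ) ρ^{(d−1)/2} G_n(ρ) dρ`. -/
def GfunA (d : ℕ) (m : ℝ) (g : ℝ → ℝ≥0∞) : ℕ → ℝ → ℝ≥0∞
  | 0 => fun _ => 1
  | n + 1 => fun r =>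
      if r ≤ 0 then 0
      else if d = 1 then
        (∫⁻ ρ in Set.Ioo (0 : ℝ) r, g (r - ρ) * g ρ * GfunA d m g n ρ) / g r
      else
        (∫⁻ ρ in Set.Ioo (0 : ℝ) r,
            ENNReal.ofReal (∫ s in (0 : ℝ)..Real.sqrt (min ρ (r - ρ)),
                Real.exp (-m * s ^ 2) * s ^ ((d : ℝ) - 2)) *
              (g (r - ρ) * ENNReal.ofReal ((r - ρ) ^ (((d : ℝ) - 1) / 2))) *
              (g ρ * ENNReal.ofReal (ρ ^ (((d : ℝ) - 1) / 2))) * GfunA d m g n ρ) /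
          (g r * ENNReal.ofReal (r ^ (((d : ℝ) - 1) / 2)))

lemma aux_beta (u v r : ℝ) (hu : 0 < u) (hv : 0 < v) (hr : 0 < r) :
    ENNReal.ofReal (r ^ (u + v - 1) * (Real.Gamma u * Real.Gamma v / Real.Gamma (u + v))) ≤
      ∫⁻ ρ in Set.Ioo (0 : ℝ) r, ENNReal.ofReal (ρ ^ (u - 1) * (r - ρ) ^ (v - 1)) := by
  have h1 : ∫ x in (0:ℝ)..r, (x ^ (u - 1) * (r - x) ^ (v - 1)) =
      r ^ (u + v - 1) * (Real.Gamma u * Real.Gamma v / Real.Gamma (u + v)) := by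
    have h2 := Complex.betaIntegral_scaled (u : ℂ) (v : ℂ) hr
    rw [Complex.betaIntegral_eq_Gamma_mul_div _ _ (by simpa) (by simpa)] at h2
    have h3 : ∫ x in (0:ℝ)..r, (x : ℂ) ^ ((u:ℂ) - 1) * ((r : ℂ) - x) ^ ((v:ℂ) - 1) =
        ∫ x in (0:ℝ)..r, ((x ^ (u - 1) * (r - x) ^ (v - 1) : ℝ) : ℂ) := by
      simp_rw [intervalIntegral.integral_of_le hr.le]
      refine setIntegral_congr_fun measurableSet_Ioc fun x hx => ?_
      have hx1 : 0 ≤ x := hx.1.le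
      have hx2 : 0 ≤ r - x := by linarith [hx.2]
      push_cast [Complex.ofReal_cpow hx1, Complex.ofReal_cpow hx2]
      rfl
    rw [h3, intervalIntegral.integral_ofReal] at h2
    apply Complex.ofReal_injective
    rw [h2]
    push_cast [Complex.ofReal_cpow hr.le, Complex.Gamma_ofReal]
    rw [← Complex.ofReal_add, Complex.Gamma_ofReal]
  rw [← h1, intervalIntegral.integral_of_le hr.le, integral_Ioc_eq_integral_Ioo,
    integral_eq_lintegral_of_nonneg_ae]
  · exact ENNReal.ofReal_toReal_le
  · refine ae_restrict_of_forall_mem measurableSet_Ioo (fun x hx ↦ ?_)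
    have hx1 : 0 ≤ x := hx.1.le
    have hx2 : 0 ≤ r - x := by linarith [hx.2]
    show 0 ≤ x ^ (u - 1) * (r - x) ^ (v - 1)
    positivity
  · exact Measurable.aestronglyMeasurable (by fun_prop)

lemma aux_kernel (d : ℕ) (hd : 2 ≤ d) (m x : ℝ) (hm : 0 < m) (hx : 0 < x) :
    Real.exp (-m) / d * (min 1 x) ^ (((d : ℝ) - 1) / 2) ≤
      ∫ s in (0 : ℝ)..Real.sqrt x, Real.exp (-m * s ^ 2) * s ^ ((d : ℝ) - 2) := by
  have hd' : (2:ℝ) ≤ d := by exact_mod_cast hd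
  have hint : ∀ a b : ℝ, IntervalIntegrable
      (fun s : ℝ => Real.exp (-m * s ^ 2) * s ^ ((d : ℝ) - 2)) volume a b := by
    intro a b
    apply Continuous.intervalIntegrable
    exact (by fun_prop : Continuous fun s : ℝ => Real.exp (-m * s ^ 2)).mul
      (Real.continuous_rpow_const (by linarith))
  have hmin : (0:ℝ) < min 1 x := lt_min one_pos hx
  have hs1 : Real.sqrt (min 1 x) ≤ 1 := Real.sqrt_le_one.mpr (min_le_left _ _)
  calc _ ≤ Real.exp (-m) * ((min 1 x) ^ (((d : ℝ) - 1) / 2) / (d - 1)) := by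
        rw [div_mul_eq_mul_div, mul_div_assoc]
        gcongr
        · linarith
        · linarith
    _ = ∫ s in (0:ℝ)..Real.sqrt (min 1 x), Real.exp (-m) * s ^ ((d : ℝ) - 2) := by
        rw [intervalIntegral.integral_const_mul, integral_rpow (Or.inl (by linarith)),
          Real.zero_rpow (by linarith), Real.sqrt_eq_rpow, ← Real.rpow_mul hmin.le]
        congr 2
        · rw [sub_zero]; congr 1; ring
        · ring
    _ ≤ ∫ s in (0:ℝ)..Real.sqrt (min 1 x), Real.exp (-m * s ^ 2) * s ^ ((d : ℝ) - 2) := by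
        apply intervalIntegral.integral_mono_on (Real.sqrt_nonneg _) _ (hint _ _)
        · intro s hs
          have h0 := hs.1
          have h1 : s ≤ 1 := hs.2.trans hs1
          gcongr
          nlinarith [mul_nonneg hm.le (by nlinarith : 0 ≤ 1 - s ^ 2)]
        · exact ((Real.continuous_rpow_const (by linarith)).const_mul _).intervalIntegrable _ _
    _ ≤ _ := by
        apply intervalIntegral.integral_mono_interval le_rfl (Real.sqrt_nonneg _)
          (Real.sqrt_le_sqrt (min_le_right _ _)) _ (hint _ _)
        refine ae_restrict_of_forall_mem measurableSet_Ioc (fun s hs ↦ ?_)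
        have := hs.1.le
        show 0 ≤ Real.exp (-m * s ^ 2) * s ^ ((d : ℝ) - 2)
        positivity

/-- Uniform lower bound for the recursion step, valid for all `d ≥ 1`. -/
lemma aux_step (d : ℕ) (hd : 1 ≤ d) (m : ℝ) (hm : 0 < m) (g : ℝ → ℝ≥0∞) (n : ℕ) (r : ℝ)
    (hr : 0 < r) :
    (∫⁻ ρ in Set.Ioo (0 : ℝ) r,
        ENNReal.ofReal (Real.exp (-m) / d * (min 1 (min ρ (r - ρ))) ^ (((d : ℝ) - 1) / 2)) *
          (g (r - ρ) * ENNReal.ofReal ((r - ρ) ^ (((d : ℝ) - 1) / 2))) *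
          (g ρ * ENNReal.ofReal (ρ ^ (((d : ℝ) - 1) / 2))) * GfunA d m g n ρ) /
      (g r * ENNReal.ofReal (r ^ (((d : ℝ) - 1) / 2))) ≤ GfunA d m g (n + 1) r := by
  rw [GfunA]
  beta_reduce
  rw [if_neg hr.not_ge]
  split_ifs with h1
  · subst h1
    simp only [Nat.cast_one, sub_self, zero_div, Real.rpow_zero, mul_one, div_one,
      ENNReal.ofReal_one]
    gcongr with ρ
    refine mul_le_of_le_one_left zero_le ?_
    rw [ENNReal.ofReal_le_one]
    exact Real.exp_le_one_iff.mpr (by linarith)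
  · have hd2 : 2 ≤ d := by omega
    refine ENNReal.div_le_div_right ?_ _
    refine setLIntegral_mono' measurableSet_Ioo fun ρ hρ => ?_
    have := aux_kernel d hd2 m (min ρ (r - ρ)) hm (lt_min hρ.1 (by linarith [hρ.2]))
    gcongr

lemma aux_min1 (r ρ : ℝ) (h0 : 0 < ρ) (h1 : ρ < r) : min 1 r * ρ / r ≤ min 1 ρ := by
  have hr : 0 < r := h0.trans h1
  rw [div_le_iff₀ hr]
  rcases le_total 1 r with h | h <;> rcases le_total 1 ρ with h' | h' <;> simp [h, h'] <;>
    nlinarith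

lemma aux_min2 (r ρ : ℝ) (h0 : 0 < ρ) (h1 : ρ < r) :
    min 1 r * ρ * (r - ρ) / r ^ 2 ≤ min 1 (min ρ (r - ρ)) := by
  have hr : 0 < r := h0.trans h1
  have h2 : 0 < r - ρ := by linarith
  have hq : min 1 r ≤ 1 := min_le_left _ _
  have hq' : min 1 r ≤ r := min_le_right _ _
  have hq0 : 0 < min 1 r := lt_min one_pos hr
  generalize min 1 r = q at *
  have e1 : ρ * (r - ρ) ≤ r ^ 2 := by nlinarith
  have e2 : q * (r - ρ) ≤ r ^ 2 := by nlinarith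
  have e3 : q * ρ ≤ r ^ 2 := by nlinarith
  rw [div_le_iff₀ (by positivity)]
  rcases min_cases 1 (min ρ (r - ρ)) with h | h
  · rw [h.1]
    nlinarith [mul_pos h0 h2]
  · rw [h.1]
    rcases min_cases ρ (r - ρ) with h | h
    · rw [h.1]; nlinarith
    · rw [h.1]; nlinarith

lemma aux_pointwise (a δ κ r ρ : ℝ) (n : ℕ) (hδ : 0 ≤ δ) (hκ : 0 ≤ κ)
    (h0 : 0 < ρ) (h1 : ρ < r) :
    ((min 1 r) ^ ((δ + κ) * (n + 1) + κ) * r ^ (-((δ + κ) * (n + 2)))) *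
      (ρ ^ ((a + δ + κ) * (n + 1) - 1) * (r - ρ) ^ (a + δ + κ - 1)) ≤
    (min 1 (min ρ (r - ρ))) ^ δ * ((r - ρ) ^ (a - 1) * (min 1 (r - ρ)) ^ κ) *
      (ρ ^ (a - 1) * (min 1 ρ) ^ κ) * (ρ ^ (a * n) * (min 1 ρ) ^ ((δ + κ) * n)) := by
  have hr : 0 < r := h0.trans h1
  have h2 : 0 < r - ρ := by linarith
  have hq0 : 0 < min 1 r := lt_min one_pos hr
  have m1 := aux_min1 r ρ h0 h1
  have m2 := aux_min1 r (r - ρ) h2 (by linarith)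
  have m3 := aux_min2 r ρ h0 h1
  generalize min 1 r = q at *
  generalize r - ρ = σ at *
  calc _ = (q * ρ * σ / r ^ 2) ^ δ * (σ ^ (a - 1) * (q * σ / r) ^ κ) *
      (ρ ^ (a - 1) * (q * ρ / r) ^ κ) * (ρ ^ (a * n) * (q * ρ / r) ^ ((δ + κ) * n)) := by
        have i1 : 0 < q * ρ * σ / r ^ 2 := by positivity
        have i2 : 0 < q * σ / r := by positivity
        have i3 : 0 < q * ρ / r := by positivity
        simp only [Real.rpow_def_of_pos h0, Real.rpow_def_of_pos h2, Real.rpow_def_of_pos hr,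
          Real.rpow_def_of_pos hq0, Real.rpow_def_of_pos i1, Real.rpow_def_of_pos i2,
          Real.rpow_def_of_pos i3, ← Real.exp_add]
        congr 1
        rw [Real.log_div (by positivity) (by positivity), Real.log_div (by positivity) hr.ne',
          Real.log_div (by positivity) hr.ne', Real.log_mul (by positivity) h2.ne',
          Real.log_mul hq0.ne' h0.ne', Real.log_mul hq0.ne' h2.ne', Real.log_pow]
        push_cast
        ring
    _ ≤ _ := by gcongr

lemma aux_main (d : ℕ) (hd : 1 ≤ d) (m γ κ : ℝ) (hm : 0 < m) (hκ : 0 ≤ κ)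
    (hγ : γ < ((d : ℝ) + 1) / 2) (g : ℝ → ℝ)
    (hg : ∀ x, 0 < x → g x = x ^ (-γ) * (min 1 x) ^ κ) (n : ℕ) :
    ∀ r : ℝ, 0 < r →
      ENNReal.ofReal ((Real.exp (-m) / d) ^ n *
        (Real.Gamma ((d : ℝ) - γ + κ) ^ (n + 1) / Real.Gamma (((d : ℝ) - γ + κ) * ((n : ℝ) + 1))) *
        (r ^ ((((d : ℝ) + 1) / 2 - γ) * (n : ℝ)) *
          (min 1 r) ^ ((((d : ℝ) - 1) / 2 + κ) * (n : ℝ)))) ≤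
      GfunA d m (fun s => ENNReal.ofReal (g s)) n r := by
  have hd' : (1:ℝ) ≤ d := by exact_mod_cast hd
  obtain ⟨δ, hδ⟩ : ∃ δ, δ = ((d : ℝ) - 1) / 2 := ⟨_, rfl⟩
  obtain ⟨a, ha⟩ : ∃ a, a = ((d : ℝ) + 1) / 2 - γ := ⟨_, rfl⟩
  have hb : (d : ℝ) - γ + κ = a + δ + κ := by rw [ha, hδ]; ring
  have hδ0 : 0 ≤ δ := by rw [hδ]; linarith
  have ha0 : 0 < a := by rw [ha]; linarith
  have hbp : 0 < a + δ + κ := by linarith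
  have hGb := Real.Gamma_pos_of_pos hbp
  have hc0 : 0 < Real.exp (-m) / d := by positivity
  have hgδ : ∀ x, 0 < x → g x * x ^ δ = x ^ (a - 1) * (min 1 x) ^ κ := by
    intro x hx
    rw [hg x hx, mul_right_comm, ← Real.rpow_add hx]
    congr 2
    rw [ha, hδ]; ring
  have hgpos : ∀ x, 0 < x → 0 < g x := by
    intro x hx
    have : 0 < min 1 x := lt_min one_pos hx
    rw [hg x hx]; positivity
  rw [hb, ← hδ, ← ha]
  induction n with
  | zero =>
    intro r hr
    simp [GfunA, div_self hGb.ne']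
  | succ n ih =>
    intro r hr
    refine le_trans ?_ (aux_step d hd m hm _ n r hr)
    rw [← hδ]
    generalize Real.exp (-m) / d = c at *
    have hq0 : 0 < min 1 r := lt_min one_pos hr
    have hbn : 0 < (a + δ + κ) * ((n:ℝ) + 1) := by positivity
    have hGbn := Real.Gamma_pos_of_pos hbn
    have hden : 0 < r ^ (a - 1) * (min 1 r) ^ κ := by positivity
    rw [← ENNReal.ofReal_mul (hgpos r hr).le, hgδ r hr,
      ENNReal.le_div_iff_mul_le (Or.inl (by simpa using hden)) (Or.inl ENNReal.ofReal_ne_top),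
      ← ENNReal.ofReal_mul' hden.le]
    set C : ℝ := c ^ n * (Real.Gamma (a + δ + κ) ^ (n + 1) /
      Real.Gamma ((a + δ + κ) * ((n:ℝ) + 1))) with hC
    have hC0 : 0 < C := by positivity
    set Q : ℝ := (min 1 r) ^ ((δ + κ) * (n + 1) + κ) * r ^ (-((δ + κ) * ((n:ℝ) + 2))) with hQ
    have hQ0 : 0 < Q := by positivity
    calc _ = ENNReal.ofReal (c * C * Q) * ENNReal.ofReal
          (r ^ ((a + δ + κ) * ((n:ℝ) + 1) + (a + δ + κ) - 1) *
            (Real.Gamma ((a + δ + κ) * ((n:ℝ) + 1)) * Real.Gamma (a + δ + κ) /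
              Real.Gamma ((a + δ + κ) * ((n:ℝ) + 1) + (a + δ + κ)))) := by
          rw [← ENNReal.ofReal_mul (by positivity)]
          congr 1
          have e1 : (a + δ + κ) * (((n + 1 : ℕ) : ℝ) + 1) =
            (a + δ + κ) * ((n:ℝ) + 1) + (a + δ + κ) := by push_cast; ring
          have e2 : r ^ (a * ((n + 1 : ℕ) : ℝ)) * min 1 r ^ ((δ + κ) * ((n + 1 : ℕ) : ℝ)) *
              (r ^ (a - 1) * min 1 r ^ κ) =
              Q * r ^ ((a + δ + κ) * ((n:ℝ) + 1) + (a + δ + κ) - 1) := by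
            rw [hQ]
            simp only [Real.rpow_def_of_pos hr, Real.rpow_def_of_pos hq0, ← Real.exp_add]
            congr 1
            push_cast
            ring
          rw [mul_assoc, e2, e1, hC]
          field_simp
          ring
    _ ≤ ENNReal.ofReal (c * C * Q) * ∫⁻ ρ in Set.Ioo (0 : ℝ) r, ENNReal.ofReal
          (ρ ^ ((a + δ + κ) * ((n:ℝ) + 1) - 1) * (r - ρ) ^ (a + δ + κ - 1)) := by
          gcongr
          exact aux_beta _ _ r hbn hbp hr
    _ = ∫⁻ ρ in Set.Ioo (0 : ℝ) r, ENNReal.ofReal (c * C * Q) * ENNReal.ofReal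
          (ρ ^ ((a + δ + κ) * ((n:ℝ) + 1) - 1) * (r - ρ) ^ (a + δ + κ - 1)) := by
          rw [lintegral_const_mul' _ _ ENNReal.ofReal_ne_top]
    _ ≤ _ := by
          refine setLIntegral_mono' measurableSet_Ioo fun ρ hρ => ?_
          have h0 : 0 < ρ := hρ.1
          have h1 : ρ < r := hρ.2
          have h2 : 0 < r - ρ := by linarith
          have j1 : 0 < min 1 ρ := lt_min one_pos h0
          have j2 : 0 < min 1 (r - ρ) := lt_min one_pos h2
          have j3 : 0 < min 1 (min ρ (r - ρ)) := lt_min one_pos (lt_min h0 h2)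
          refine le_trans ?_ (mul_le_mul_right (ih ρ h0) _)
          rw [← ENNReal.ofReal_mul (hgpos _ h2).le, ← ENNReal.ofReal_mul (hgpos _ h0).le,
            hgδ _ h2, hgδ _ h0, ← ENNReal.ofReal_mul (by positivity),
            ← ENNReal.ofReal_mul (by positivity), ← ENNReal.ofReal_mul (by positivity),
            ← ENNReal.ofReal_mul (by positivity)]
          apply ENNReal.ofReal_le_ofReal
          have key := mul_le_mul_of_nonneg_left (aux_pointwise a δ κ r ρ n hδ0 hκ h0 h1)
            (mul_pos hc0 hC0).le
          rw [← hQ] at key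
          convert! key using 1 <;> ring

/-- Let `d ≥ 1`, `m > 0`, `γ ∈ [0,(d+1)/2)`. There is a constant
`c ∈ (0,1]` (depending only on `d, γ, m`) such that for every `r ≥ 1` and `n ≥ 1`
(written `n+1`): (i) for `g(r) = r^{−γ}`,
`G_{n+1}(r) ≥ c^n (Γ(d−γ)^{n+1}/Γ((d−γ)(n+1))) r^{((d+1)/2−γ)n}`; and (ii) for
`g(r) = (max(1,r))^{−γ}`, `G_{n+1}(r) ≥ c^n (Γ(d)^{n+1}/Γ(d(n+1))) r^{((d+1)/2−γ)n}`. -/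
theorem stmt19 (d : ℕ) (hd : 1 ≤ d) (m γ : ℝ) (hm : 0 < m)
    (hγ0 : 0 ≤ γ) (hγ : γ < ((d : ℝ) + 1) / 2) :
    ∃ c : ℝ, 0 < c ∧ c ≤ 1 ∧
      ∀ (r : ℝ), 1 ≤ r → ∀ n : ℕ,
        ENNReal.ofReal (c ^ n *
            (Real.Gamma ((d : ℝ) - γ) ^ (n + 1) / Real.Gamma (((d : ℝ) - γ) * ((n : ℝ) + 1))) *
            r ^ ((((d : ℝ) + 1) / 2 - γ) * (n : ℝ))) ≤
          GfunA d m (fun s => ENNReal.ofReal (s ^ (-γ))) n r ∧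
        ENNReal.ofReal (c ^ n *
            (Real.Gamma (d : ℝ) ^ (n + 1) / Real.Gamma ((d : ℝ) * ((n : ℝ) + 1))) *
            r ^ ((((d : ℝ) + 1) / 2 - γ) * (n : ℝ))) ≤
          GfunA d m (fun s => ENNReal.ofReal ((max 1 s) ^ (-γ))) n r := by
  have hd' : (1:ℝ) ≤ d := by exact_mod_cast hd
  refine ⟨Real.exp (-m) / d, by positivity, ?_, ?_⟩
  · rw [div_le_one (by positivity)]
    exact (Real.exp_le_one_iff.mpr (by linarith)).trans hd'
  intro r hr n
  have hr0 : 0 < r := by linarith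
  constructor
  · have h := aux_main d hd m γ 0 hm le_rfl hγ (fun s => s ^ (-γ)) (by intro x _; simp) n r hr0
    rw [min_eq_left hr, Real.one_rpow, mul_one, add_zero] at h
    exact h
  · have h := aux_main d hd m γ γ hm hγ0 hγ (fun s => (max 1 s) ^ (-γ)) (by
      intro x hx
      have hq : 0 < min 1 x := lt_min one_pos hx
      have hM : 0 < max 1 x := lt_max_of_lt_left one_pos
      have e : x = min 1 x * max 1 x := by rw [min_mul_max, one_mul]
      calc (max 1 x) ^ (-γ) = (min 1 x * max 1 x) ^ (-γ) * (min 1 x) ^ γ := by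
            rw [Real.mul_rpow hq.le hM.le, mul_right_comm, ← Real.rpow_add hq]
            simp
        _ = _ := by rw [← e]) n r hr0
    rw [min_eq_left hr, Real.one_rpow, mul_one, sub_add_cancel] at h
    exact h
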